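/- Identification in the bivariate causal analogue of the block-parallel model under rank preservation: let A_1, A_2 ∈ {0,1} be treatments, X_1^{(0)}, X_1^{(1)} counterfactual variables with values in a finite set α, X_2^{(0)}, X_2^{(1)} counterfactual variables with values in a finite set β, and observed outcomes X_1 := X_1^{(A_1)}, X_2 := X_2^{(A_2)} (consistency). Assume the joint law is strictly positive on its finite state space and: (C1) P(A_2 = a_2 | X_1^{(0)}, X_1^{(1)}, X_2^{(0)}, X_2^{(1)}, A_1) = P(A_2 = a_2 | X_1^{(0)}, X_1^{(1)}) pointwise; (C2) P(A_1 = a_1 | X_1^{(0)}, X_1^{(1)}, X_2^{(0)}, X_2^{(1)}, A_2) = P(A_1 = a_1 | X_2^{(0)}, X_2^{(1)}) pointwise; and (RP) rank preservation: there exist bijections g_1 : α → α and g_2 : β → β with X_1^{(0)} = g_1(X_1^{(1)}) and X_2^{(0)} = g_2(X_2^{(1)}) everywhere on Ω. Then for every (i, j) ∈ {0,1}² and all values x_1 ∈ α, x_2 ∈ β: P(X_1^{(i)} = x_1, X_2^{(j)} = x_2) = P(X_1 = x_1, X_2 = x_2, A_1 = i, A_2 = j) / [ P(A_1 = i | X_2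 = x_2, A_2 = j) · P(A_2 = j | X_1 = x_1, A_1 = i) ]. -/

import Mathlib

open MeasureTheory

/-- `Pr P A` is the probability of the event `A` under the probability measure `P`. -/
noncomputable def Pr {Ω : Type*} [MeasurableSpace Ω] (P : Measure Ω) (A : Set Ω) : ℝ :=
  (P A).toReal

/-- `cPr P A B` is the conditional probability `P(A | B) = P(A ∩ B) / P(B)`. -/
noncomputable def cPr {Ω : Type*} [MeasurableSpace Ω] (P : Measure Ω) (A B : Set Ω) : ℝ :=
  Pr P (A ∩ B) / Pr P B

/-- The law of total probability along a finite-valued random variable. -/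
lemma Pr_eq_sum_inter {Ω γ : Type*} [MeasurableSpace Ω] [Fintype γ] (P : Measure Ω)
    [IsFiniteMeasure P] (Y : Ω → γ) (hY : ∀ y, MeasurableSet {ω | Y ω = y}) (S : Set Ω) :
    Pr P S = ∑ y, Pr P ({ω | Y ω = y} ∩ S) := by
  have h : P S = ∑ y, P ({ω | Y ω = y} ∩ S) := by
    have := sum_measure_preimage_singleton (μ := P.restrict S) (f := Y) Finset.univ
      fun y _ => hY y
    simp only [Finset.coe_univ, Set.preimage_univ, Measure.restrict_apply_univ] at this
    rw [← this]
    exact Finset.sum_congr rfl fun y _ => Measure.restrict_apply (hY y)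
  simp only [Pr]
  rw [h, ENNReal.toReal_sum fun y _ => measure_ne_top P _]

/-- If an event has probability `c` given each value of `Y` within `B`, it has probability `c`
given `B`; stated multiplicatively. -/
lemma Pr_inter_eq_mul_of_forall {Ω γ : Type*} [MeasurableSpace Ω] [Fintype γ] (P : Measure Ω)
    [IsFiniteMeasure P] (Y : Ω → γ) (hY : ∀ y, MeasurableSet {ω | Y ω = y}) {A B : Set Ω} {c : ℝ}
    (h : ∀ y, Pr P (A ∩ ({ω | Y ω = y} ∩ B)) = c * Pr P ({ω | Y ω = y} ∩ B)) :
    Pr P (A ∩ B) = c * Pr P B := by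
  rw [Pr_eq_sum_inter P Y hY (A ∩ B), Pr_eq_sum_inter P Y hY B, Finset.mul_sum]
  refine Finset.sum_congr rfl fun y _ => ?_
  rw [← h y, Set.inter_left_comm]

lemma Pr_nonneg {Ω : Type*} [MeasurableSpace Ω] (P : Measure Ω) (A : Set Ω) : 0 ≤ Pr P A :=
  ENNReal.toReal_nonneg

lemma Pr_mono {Ω : Type*} [MeasurableSpace Ω] (P : Measure Ω) [IsFiniteMeasure P] {A B : Set Ω}
    (h : A ⊆ B) : Pr P A ≤ Pr P B :=
  ENNReal.toReal_mono (measure_ne_top P B) (measure_mono h)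

lemma Pr_inter_eq_mul_of_cPr_eq {Ω : Type*} [MeasurableSpace Ω] (P : Measure Ω)
    [IsFiniteMeasure P] {A B : Set Ω} {c : ℝ} (h : 0 < Pr P B → cPr P A B = c) :
    Pr P (A ∩ B) = c * Pr P B := by
  rcases (Pr_nonneg P B).eq_or_lt with h0 | h0
  · rw [← h0, mul_zero]
    exact le_antisymm (h0 ▸ Pr_mono P Set.inter_subset_right) (Pr_nonneg P _)
  · rw [← h h0, cPr, div_mul_cancel₀ _ h0.ne']

/-- Under rank preservation, each counterfactual determines the pair of counterfactuals. -/
lemma exists_eq_iff_pair {Ω γ : Type*} (Xc : Bool → Ω → γ) (g : γ ≃ γ)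
    (hRP : ∀ ω, Xc false ω = g (Xc true ω)) (i : Bool) (x : γ) :
    ∃ u₀ u₁, ∀ ω, Xc i ω = x ↔ Xc false ω = u₀ ∧ Xc true ω = u₁ := by
  cases i
  · refine ⟨x, g.symm x, fun ω => ⟨fun h => ⟨h, ?_⟩, And.left⟩⟩
    rw [Equiv.eq_symm_apply, ← hRP, h]
  · exact ⟨g x, x, fun ω => ⟨fun h => ⟨by rw [hRP, h], h⟩, And.right⟩⟩

/-- Identification when `W` and `Z` are such that `A` depends only on `Z`, and `B` only on `W`. -/
lemma Pr_eq_div_of_cond {Ω α β : Type*} [MeasurableSpace Ω] (P : Measure Ω)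
    [IsFiniteMeasure P] [Fintype α] [Fintype β] (A B : Ω → Bool) (W : Ω → α) (Z : Ω → β)
    (hB : ∀ b, MeasurableSet {ω | B ω = b})
    (hW : ∀ x, MeasurableSet {ω | W ω = x}) (hZ : ∀ y, MeasurableSet {ω | Z ω = y})
    (i j : Bool) (x : α) (y : β) {c d : ℝ}
    (hpos : 0 < Pr P {ω | W ω = x ∧ Z ω = y ∧ A ω = i ∧ B ω = j})
    (hc : ∀ z, Pr P ({ω | B ω = j} ∩ {ω | W ω = x ∧ Z ω = z ∧ A ω = i})
      = c * Pr P {ω | W ω = x ∧ Z ω = z ∧ A ω = i})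
    (hd : ∀ w b, Pr P ({ω | A ω = i} ∩ {ω | W ω = w ∧ Z ω = y ∧ B ω = b})
      = d * Pr P {ω | W ω = w ∧ Z ω = y ∧ B ω = b}) :
    Pr P {ω | W ω = x ∧ Z ω = y} = Pr P {ω | W ω = x ∧ Z ω = y ∧ A ω = i ∧ B ω = j}
      / (cPr P {ω | A ω = i} {ω | Z ω = y ∧ B ω = j}
        * cPr P {ω | B ω = j} {ω | W ω = x ∧ A ω = i}) := by
  have hci : Pr P ({ω | B ω = j} ∩ {ω | W ω = x ∧ A ω = i})
      = c * Pr P {ω | W ω = x ∧ A ω = i} := by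
    refine Pr_inter_eq_mul_of_forall P Z hZ fun z => ?_
    have h : {ω | Z ω = z} ∩ {ω | W ω = x ∧ A ω = i} = {ω | W ω = x ∧ Z ω = z ∧ A ω = i} := by
      ext ω; simp only [Set.mem_inter_iff, Set.mem_ofPred_eq]; tauto
    rw [h, hc]
  have hdj : Pr P ({ω | A ω = i} ∩ {ω | Z ω = y ∧ B ω = j})
      = d * Pr P {ω | Z ω = y ∧ B ω = j} :=
    Pr_inter_eq_mul_of_forall P W hW fun w => hd w j
  have hdxy : Pr P ({ω | A ω = i} ∩ {ω | W ω = x ∧ Z ω = y})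
      = d * Pr P {ω | W ω = x ∧ Z ω = y} := by
    refine Pr_inter_eq_mul_of_forall P B hB fun b => ?_
    have h : {ω | B ω = b} ∩ {ω | W ω = x ∧ Z ω = y} = {ω | W ω = x ∧ Z ω = y ∧ B ω = b} := by
      ext ω; simp only [Set.mem_inter_iff, Set.mem_ofPred_eq]; tauto
    rw [h, hd]
  have hjoint : Pr P {ω | W ω = x ∧ Z ω = y ∧ A ω = i ∧ B ω = j}
      = c * (d * Pr P {ω | W ω = x ∧ Z ω = y}) := by
    have h₁ : {ω | W ω = x ∧ Z ω = y ∧ A ω = i ∧ B ω = j}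
        = {ω | B ω = j} ∩ {ω | W ω = x ∧ Z ω = y ∧ A ω = i} := by
      ext ω; simp only [Set.mem_inter_iff, Set.mem_ofPred_eq]; tauto
    have h₂ : {ω | W ω = x ∧ Z ω = y ∧ A ω = i} = {ω | A ω = i} ∩ {ω | W ω = x ∧ Z ω = y} := by
      ext ω; simp only [Set.mem_inter_iff, Set.mem_ofPred_eq]; tauto
    rw [h₁, hc, h₂, hdxy]
  have hxi : 0 < Pr P {ω | W ω = x ∧ A ω = i} :=
    hpos.trans_le (Pr_mono P fun _ h => ⟨h.1, h.2.2.1⟩)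
  have hyj : 0 < Pr P {ω | Z ω = y ∧ B ω = j} :=
    hpos.trans_le (Pr_mono P fun _ h => ⟨h.2.1, h.2.2.2⟩)
  have hne : c * (d * Pr P {ω | W ω = x ∧ Z ω = y}) ≠ 0 := hjoint ▸ hpos.ne'
  have hc0 : c ≠ 0 := left_ne_zero_of_mul hne
  have hd0 : d ≠ 0 := left_ne_zero_of_mul (right_ne_zero_of_mul hne)
  rw [cPr, cPr, hci, hdj, hjoint, mul_div_cancel_right₀ _ hxi.ne', mul_div_cancel_right₀ _ hyj.ne']
  field_simp

/-- identification in the bivariate causal analogue of the block-parallel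
model under rank preservation. -/
theorem bivariate_block_parallel_causal_rank_preservation
    {Ω : Type*} [MeasurableSpace Ω] (P : Measure Ω) [IsProbabilityMeasure P]
    {α β : Type*} [Fintype α] [Nonempty α] [Fintype β] [Nonempty β]
    (A₁ A₂ : Ω → Bool)
    (X₁c : Bool → Ω → α) (X₂c : Bool → Ω → β)
    (X₁ : Ω → α) (X₂ : Ω → β)
    -- consistency
    (hX₁ : ∀ ω, X₁ ω = X₁c (A₁ ω) ω) (hX₂ : ∀ ω, X₂ ω = X₂c (A₂ ω) ω)
    -- measurability of the random variables
    (hmA₁ : ∀ b, MeasurableSet {ω | A₁ ω = b})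
    (hmA₂ : ∀ b, MeasurableSet {ω | A₂ ω = b})
    (hmX₁c : ∀ b a, MeasurableSet {ω | X₁c b ω = a})
    (hmX₂c : ∀ b a, MeasurableSet {ω | X₂c b ω = a})
    -- strict positivity of the joint law
    (hpos : ∀ (x₁ : α) (x₂ : β) (a₁ a₂ : Bool),
      0 < Pr P {ω | X₁ ω = x₁ ∧ X₂ ω = x₂ ∧ A₁ ω = a₁ ∧ A₂ ω = a₂})
    -- (C1)
    (hC1 : ∀ (a₂ : Bool) (u₀ u₁ : α) (v₀ v₁ : β) (a₁ : Bool),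
      0 < Pr P {ω | X₁c false ω = u₀ ∧ X₁c true ω = u₁ ∧ X₂c false ω = v₀ ∧
        X₂c true ω = v₁ ∧ A₁ ω = a₁} →
      cPr P {ω | A₂ ω = a₂}
        {ω | X₁c false ω = u₀ ∧ X₁c true ω = u₁ ∧ X₂c false ω = v₀ ∧
          X₂c true ω = v₁ ∧ A₁ ω = a₁}
        = cPr P {ω | A₂ ω = a₂} {ω | X₁c false ω = u₀ ∧ X₁c true ω = u₁})
    -- (C2)
    (hC2 : ∀ (a₁ : Bool) (u₀ u₁ : α) (v₀ v₁ : β) (a₂ : Bool),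
      0 < Pr P {ω | X₁c false ω = u₀ ∧ X₁c true ω = u₁ ∧ X₂c false ω = v₀ ∧
        X₂c true ω = v₁ ∧ A₂ ω = a₂} →
      cPr P {ω | A₁ ω = a₁}
        {ω | X₁c false ω = u₀ ∧ X₁c true ω = u₁ ∧ X₂c false ω = v₀ ∧
          X₂c true ω = v₁ ∧ A₂ ω = a₂}
        = cPr P {ω | A₁ ω = a₁} {ω | X₂c false ω = v₀ ∧ X₂c true ω = v₁})
    -- (RP) rank preservation
    (g₁ : α ≃ α) (g₂ : β ≃ β)
    (hRP₁ : ∀ ω, X₁c false ω = g₁ (X₁c true ω))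
    (hRP₂ : ∀ ω, X₂c false ω = g₂ (X₂c true ω)) :
    ∀ (i j : Bool) (x₁ : α) (x₂ : β),
      Pr P {ω | X₁c i ω = x₁ ∧ X₂c j ω = x₂}
        = Pr P {ω | X₁ ω = x₁ ∧ X₂ ω = x₂ ∧ A₁ ω = i ∧ A₂ ω = j}
          / (cPr P {ω | A₁ ω = i} {ω | X₂ ω = x₂ ∧ A₂ ω = j}
            * cPr P {ω | A₂ ω = j} {ω | X₁ ω = x₁ ∧ A₁ ω = i}) := by
  intro i j x₁ x₂
  have hjoint : ∀ x y, {ω | X₁ ω = x ∧ X₂ ω = y ∧ A₁ ω = i ∧ A₂ ω = j}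
      = {ω | X₁c i ω = x ∧ X₂c j ω = y ∧ A₁ ω = i ∧ A₂ ω = j} := by
    intro x y; ext ω; simp only [Set.mem_ofPred_eq, hX₁, hX₂]
    constructor <;> rintro ⟨h₁, h₂, rfl, rfl⟩ <;> exact ⟨h₁, h₂, rfl, rfl⟩
  have hX₁i : {ω | X₁ ω = x₁ ∧ A₁ ω = i} = {ω | X₁c i ω = x₁ ∧ A₁ ω = i} := by
    ext ω; simp only [Set.mem_ofPred_eq, hX₁]
    constructor <;> rintro ⟨h, rfl⟩ <;> exact ⟨h, rfl⟩
  have hX₂j : {ω | X₂ ω = x₂ ∧ A₂ ω = j} = {ω | X₂c j ω = x₂ ∧ A₂ ω = j} := by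
    ext ω; simp only [Set.mem_ofPred_eq, hX₂]
    constructor <;> rintro ⟨h, rfl⟩ <;> exact ⟨h, rfl⟩
  have hpair₁ := exists_eq_iff_pair X₁c g₁ hRP₁ i
  have hpair₂ := exists_eq_iff_pair X₂c g₂ hRP₂ j
  rw [hjoint, hX₁i, hX₂j]
  refine Pr_eq_div_of_cond P A₁ A₂ (X₁c i) (X₂c j) hmA₂ (hmX₁c i) (hmX₂c j) i j x₁ x₂
    (c := cPr P {ω | A₂ ω = j} {ω | X₁c i ω = x₁})
    (d := cPr P {ω | A₁ ω = i} {ω | X₂c j ω = x₂}) (hjoint x₁ x₂ ▸ hpos x₁ x₂ i j)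
    (fun z => Pr_inter_eq_mul_of_cPr_eq P ?_) (fun w b => Pr_inter_eq_mul_of_cPr_eq P ?_)
  · obtain ⟨u₀, u₁, hu⟩ := hpair₁ x₁
    obtain ⟨v₀, v₁, hv⟩ := hpair₂ z
    simpa only [hu, hv, and_assoc] using hC1 j u₀ u₁ v₀ v₁ i
  · obtain ⟨u₀, u₁, hu⟩ := hpair₁ w
    obtain ⟨v₀, v₁, hv⟩ := hpair₂ x₂
    simpa only [hu, hv, and_assoc] using hC2 i u₀ u₁ v₀ v₁ b
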